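/- arXiv:1510.01900 — 2 statements merged into one kernel-verified Lean document; each statement's English description precedes it below -/
import Mathlib

section
/- (Covering move existence) If γ and τ are (p,q)-clans with γ < τ in the combinatorial Bruhat order, then there exists a (p,q)-clan γ' with γ < γ' ≤ τ such that γ' is obtained from γ by one of the following local moves: +- → 11; -+ → 11; 11+ → 1+1; 11- → 1-1; +11 → 1+1; -11 → 1-1; 1122 → 1212; 1122 → 1+-1; 1122 → 1-+1; 1212 → 1221. -/
open Finset

/-- A `(p,q)`-clan: an involution of `{1,…,n}` (`n = p+q`, realized as `Fin (p+q)`)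
with each fixed point decorated by a sign (`true` = `+`, `false` = `-`), normalized so
that non-fixed points carry the default sign `true`, and such that
`(#+ fixed points) - (#- fixed points) = p - q`. -/
structure Clan (p q : ℕ) where
  invol : Equiv.Perm (Fin (p + q))
  invol_invol : ∀ a, invol (invol a) = a
  sgn : Fin (p + q) → Bool
  sgn_default : ∀ a, invol a ≠ a → sgn a = true
  balance :
    ((Finset.univ : Finset (Fin (p + q))).filter
        (fun a => invol a = a ∧ sgn a = true)).card + q =
    ((Finset.univ : Finset (Fin (p + q))).filter
        (fun a => invol a = a ∧ sgn a = false)).card + p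

namespace Clan

variable {p q : ℕ}

/-- `γ(i;+)`: the number of `+` fixed points among (1-based) positions `1..i`, plus the
number of 2-cycles contained in `[1,i]` (each 2-cycle counted once, via its smaller element). -/
def rankP (γ : Clan p q) (i : ℕ) : ℕ :=
  ((Finset.univ : Finset (Fin (p + q))).filter
      (fun a => γ.invol a = a ∧ γ.sgn a = true ∧ a.val < i)).card +
  ((Finset.univ : Finset (Fin (p + q))).filter
      (fun a => a.val < (γ.invol a).val ∧ (γ.invol a).val < i)).card

/-- `γ(i;-)`: the number of `-` fixed points among positions `1..i`, plus the
number of 2-cycles contained in `[1,i]`. -/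
def rankM (γ : Clan p q) (i : ℕ) : ℕ :=
  ((Finset.univ : Finset (Fin (p + q))).filter
      (fun a => γ.invol a = a ∧ γ.sgn a = false ∧ a.val < i)).card +
  ((Finset.univ : Finset (Fin (p + q))).filter
      (fun a => a.val < (γ.invol a).val ∧ (γ.invol a).val < i)).card

/-- `γ(i;j)`: the number of 2-cycles `{s,t}` (1-based) with `s ≤ i < j < t`. -/
def rankJ (γ : Clan p q) (i j : ℕ) : ℕ :=
  ((Finset.univ : Finset (Fin (p + q))).filter
      (fun a => a.val < i ∧ j ≤ (γ.invol a).val)).card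

/-- The combinatorial Bruhat order:
`γ ≤ τ` iff `γ(i;±) ≥ τ(i;±)` for all `i` and `γ(i;j) ≤ τ(i;j)` for all `i < j`. -/
def le (γ τ : Clan p q) : Prop :=
  (∀ i, τ.rankP i ≤ γ.rankP i) ∧ (∀ i, τ.rankM i ≤ γ.rankM i) ∧
  (∀ i j, i < j → γ.rankJ i j ≤ τ.rankJ i j)

def lt (γ τ : Clan p q) : Prop := Clan.le γ τ ∧ γ ≠ τ

end Clan

section Moves

variable {p q : ℕ}

/-- The move `+- → 11`: a `+` fixed point at `i` and a `-` fixed point at `j > i` are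
replaced by the 2-cycle `{i,j}`. -/
def MovePM (γ γ' : Clan p q) : Prop :=
  ∃ i j : Fin (p + q), i < j ∧
    γ.invol i = i ∧ γ.sgn i = true ∧ γ.invol j = j ∧ γ.sgn j = false ∧
    γ'.invol i = j ∧
    (∀ a, a ≠ i → a ≠ j → γ'.invol a = γ.invol a ∧ γ'.sgn a = γ.sgn a)

/-- The move `-+ → 11`. -/
def MoveMP (γ γ' : Clan p q) : Prop :=
  ∃ i j : Fin (p + q), i < j ∧
    γ.invol i = i ∧ γ.sgn i = false ∧ γ.invol j = j ∧ γ.sgn j = true ∧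
    γ'.invol i = j ∧
    (∀ a, a ≠ i → a ≠ j → γ'.invol a = γ.invol a ∧ γ'.sgn a = γ.sgn a)

/-- The move `11+ → 1+1`: a 2-cycle `{i,j}` and a `+` fixed point `k > j` become the
2-cycle `{i,k}` and a `+` fixed point at `j`. -/
def Move11P (γ γ' : Clan p q) : Prop :=
  ∃ i j k : Fin (p + q), i < j ∧ j < k ∧
    γ.invol i = j ∧ γ.invol k = k ∧ γ.sgn k = true ∧
    γ'.invol i = k ∧ γ'.invol j = j ∧ γ'.sgn j = true ∧
    (∀ a, a ≠ i → a ≠ j → a ≠ k → γ'.invol a = γ.invol a ∧ γ'.sgn a = γ.sgn a)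

/-- The move `11- → 1-1`. -/
def Move11M (γ γ' : Clan p q) : Prop :=
  ∃ i j k : Fin (p + q), i < j ∧ j < k ∧
    γ.invol i = j ∧ γ.invol k = k ∧ γ.sgn k = false ∧
    γ'.invol i = k ∧ γ'.invol j = j ∧ γ'.sgn j = false ∧
    (∀ a, a ≠ i → a ≠ j → a ≠ k → γ'.invol a = γ.invol a ∧ γ'.sgn a = γ.sgn a)

/-- The move `+11 → 1+1`: a `+` fixed point `i` and a 2-cycle `{j,k}` with `i < j < k`
become the 2-cycle `{i,k}` and a `+` fixed point at `j`. -/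
def MoveP11 (γ γ' : Clan p q) : Prop :=
  ∃ i j k : Fin (p + q), i < j ∧ j < k ∧
    γ.invol i = i ∧ γ.sgn i = true ∧ γ.invol j = k ∧
    γ'.invol i = k ∧ γ'.invol j = j ∧ γ'.sgn j = true ∧
    (∀ a, a ≠ i → a ≠ j → a ≠ k → γ'.invol a = γ.invol a ∧ γ'.sgn a = γ.sgn a)

/-- The move `-11 → 1-1`. -/
def MoveM11 (γ γ' : Clan p q) : Prop :=
  ∃ i j k : Fin (p + q), i < j ∧ j < k ∧
    γ.invol i = i ∧ γ.sgn i = false ∧ γ.invol j = k ∧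
    γ'.invol i = k ∧ γ'.invol j = j ∧ γ'.sgn j = false ∧
    (∀ a, a ≠ i → a ≠ j → a ≠ k → γ'.invol a = γ.invol a ∧ γ'.sgn a = γ.sgn a)

/-- The move `1122 → 1212`: 2-cycles `{i,j}`, `{k,l}` (`i < j < k < l`) become
`{i,k}`, `{j,l}`. -/
def Move1122_1212 (γ γ' : Clan p q) : Prop :=
  ∃ i j k l : Fin (p + q), i < j ∧ j < k ∧ k < l ∧
    γ.invol i = j ∧ γ.invol k = l ∧
    γ'.invol i = k ∧ γ'.invol j = l ∧
    (∀ a, a ≠ i → a ≠ j → a ≠ k → a ≠ l → γ'.invol a = γ.invol a) ∧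
    (∀ a, γ'.sgn a = γ.sgn a)

/-- The move `1122 → 1+-1`: 2-cycles `{i,j}`, `{k,l}` become the 2-cycle `{i,l}` with a
`+` fixed point at `j` and a `-` fixed point at `k`. -/
def Move1122_PM (γ γ' : Clan p q) : Prop :=
  ∃ i j k l : Fin (p + q), i < j ∧ j < k ∧ k < l ∧
    γ.invol i = j ∧ γ.invol k = l ∧
    γ'.invol i = l ∧ γ'.invol j = j ∧ γ'.sgn j = true ∧
    γ'.invol k = k ∧ γ'.sgn k = false ∧
    (∀ a, a ≠ i → a ≠ j → a ≠ k → a ≠ l → γ'.invol a = γ.invol a ∧ γ'.sgn a = γ.sgn a)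

/-- The move `1122 → 1-+1`. -/
def Move1122_MP (γ γ' : Clan p q) : Prop :=
  ∃ i j k l : Fin (p + q), i < j ∧ j < k ∧ k < l ∧
    γ.invol i = j ∧ γ.invol k = l ∧
    γ'.invol i = l ∧ γ'.invol j = j ∧ γ'.sgn j = false ∧
    γ'.invol k = k ∧ γ'.sgn k = true ∧
    (∀ a, a ≠ i → a ≠ j → a ≠ k → a ≠ l → γ'.invol a = γ.invol a ∧ γ'.sgn a = γ.sgn a)

/-- The move `1212 → 1221`: 2-cycles `{i,k}`, `{j,l}` (`i < j < k < l`) become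
`{i,l}`, `{j,k}`. -/
def Move1212_1221 (γ γ' : Clan p q) : Prop :=
  ∃ i j k l : Fin (p + q), i < j ∧ j < k ∧ k < l ∧
    γ.invol i = k ∧ γ.invol j = l ∧
    γ'.invol i = l ∧ γ'.invol j = k ∧
    (∀ a, a ≠ i → a ≠ j → a ≠ k → a ≠ l → γ'.invol a = γ.invol a) ∧
    (∀ a, γ'.sgn a = γ.sgn a)

/-- `γ'` is obtained from `γ` by one of the ten local moves. -/
def IsMove (γ γ' : Clan p q) : Prop :=
  MovePM γ γ' ∨ MoveMP γ γ' ∨ Move11P γ γ' ∨ Move11M γ γ' ∨ MoveP11 γ γ' ∨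
  MoveM11 γ γ' ∨ Move1122_1212 γ γ' ∨ Move1122_PM γ γ' ∨ Move1122_MP γ γ' ∨
  Move1212_1221 γ γ'

end Moves

namespace Clan

variable {p q : ℕ}

/-- The common form of `rankP` (`s = true`) and `rankM` (`s = false`). -/
def rank (γ : Clan p q) (s : Bool) (i : ℕ) : ℕ :=
  ((Finset.univ : Finset (Fin (p + q))).filter
      (fun a => γ.invol a = a ∧ γ.sgn a = s ∧ a.val < i)).card +
  ((Finset.univ : Finset (Fin (p + q))).filter
      (fun a => a.val < (γ.invol a).val ∧ (γ.invol a).val < i)).card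

/-- Contribution of position `a`, with image `b` and sign `t`, to `rank s i`. -/
def rankTerm (s : Bool) (i a b : ℕ) (t : Bool) : ℤ :=
  (if b = a ∧ t = s ∧ a < i then 1 else 0) + (if a < b ∧ b < i then 1 else 0)

/-- Contribution of position `a`, with image `b` and sign `t`, to `(#+) - (#-)`. -/
def signTerm (a b : ℕ) (t : Bool) : ℤ :=
  if b = a then (if t = true then 1 else -1) else 0

theorem rank_eq_sum (γ : Clan p q) (s : Bool) (i : ℕ) :
    (γ.rank s i : ℤ) = ∑ a : Fin (p + q), rankTerm s i a (γ.invol a) (γ.sgn a) := by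
  simp only [rank, rankTerm, Finset.sum_add_distrib, Finset.card_filter, Fin.ext_iff]
  push_cast
  rfl

theorem rankJ_eq_sum (γ : Clan p q) (i j : ℕ) :
    (γ.rankJ i j : ℤ) = ∑ a : Fin (p + q), if a.val < i ∧ j ≤ (γ.invol a).val then 1 else 0 := by
  simp only [rankJ, Finset.card_filter]
  push_cast
  rfl

theorem sum_signTerm {n : ℕ} (g : Fin n → Fin n) (σ : Fin n → Bool) :
    ∑ a : Fin n, signTerm a (g a) (σ a) =
      ((Finset.univ.filter (fun a => g a = a ∧ σ a = true)).card : ℤ) -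
      ((Finset.univ.filter (fun a => g a = a ∧ σ a = false)).card : ℤ) := by
  simp only [Finset.card_filter]
  push_cast
  rw [← Finset.sum_sub_distrib]
  refine Finset.sum_congr rfl fun a _ => ?_
  by_cases h : g a = a <;> cases hs : σ a <;> simp [signTerm, h] <;>
    (intro h'; exact absurd (Fin.ext h') h)

theorem sum_sub_sum_eq {n : ℕ} (S : Finset (Fin n)) (F G : Fin n → ℤ)
    (h : ∀ a, a ∉ S → F a = G a) : ∑ a, F a - ∑ a, G a = ∑ a ∈ S, (F a - G a) := by
  rw [← Finset.sum_sub_distrib]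
  exact (Finset.sum_subset (Finset.subset_univ S) (by intro a _ ha; simp [h a ha])).symm

/-- A clan can be altered on a set `S` of positions, as long as the result is an involution and
the signed count of fixed points is unchanged. The ranks change by the contributions of `S`. -/
theorem exists_modify (γ : Clan p q) (S : Finset (Fin (p + q)))
    (g : Fin (p + q) → Fin (p + q)) (σ : Fin (p + q) → Bool)
    (hg : ∀ a, g (g a) = a) (hσ : ∀ a, g a ≠ a → σ a = true)
    (hoff : ∀ a, a ∉ S → g a = γ.invol a ∧ σ a = γ.sgn a)
    (hbal : ∑ a ∈ S, (signTerm a (g a) (σ a) - signTerm a (γ.invol a) (γ.sgn a)) = 0) :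
    ∃ γ' : Clan p q, (∀ a, γ'.invol a = g a) ∧ (∀ a, γ'.sgn a = σ a) ∧
      (∀ s i, (γ'.rank s i : ℤ) = γ.rank s i +
        ∑ a ∈ S, (rankTerm s i a (γ'.invol a) (γ'.sgn a) -
          rankTerm s i a (γ.invol a) (γ.sgn a))) ∧
      (∀ i j, (γ'.rankJ i j : ℤ) = γ.rankJ i j +
        ∑ a ∈ S, ((if a.val < i ∧ j ≤ (γ'.invol a).val then 1 else 0) -
          (if a.val < i ∧ j ≤ (γ.invol a).val then 1 else 0))) := by
  refine ⟨⟨⟨g, g, hg, hg⟩, hg, σ, hσ, ?_⟩, fun _ => rfl, fun _ => rfl, ?_, ?_⟩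
  · rw [← sum_sub_sum_eq S (fun a => signTerm a (g a) (σ a))
      (fun a => signTerm a (γ.invol a) (γ.sgn a)) (fun a ha => by simp [hoff a ha])] at hbal
    rw [sum_signTerm, sum_signTerm] at hbal
    have := γ.balance
    simp only [Equiv.coe_fn_mk]
    omega
  · intro s i
    simp only [Equiv.coe_fn_mk]
    rw [← sum_sub_sum_eq S (fun a => rankTerm s i a (g a) (σ a))
      (fun a => rankTerm s i a (γ.invol a) (γ.sgn a)) (fun a ha => by simp [hoff a ha])]
    rw [rank_eq_sum, rank_eq_sum]
    simp
  · intro i j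
    simp only [Equiv.coe_fn_mk]
    rw [← sum_sub_sum_eq S (fun a => if a.val < i ∧ j ≤ (g a).val then 1 else 0)
      (fun a => if a.val < i ∧ j ≤ (γ.invol a).val then 1 else 0)
      (fun a ha => by simp [hoff a ha])]
    rw [rankJ_eq_sum, rankJ_eq_sum]
    simp

theorem exists_pair_of_fixed (γ : Clan p q) (s : Bool) {i k : Fin (p + q)} (hik : i < k)
    (h1 : γ.invol i = i) (s1 : γ.sgn i = s) (h2 : γ.invol k = k) (s2 : γ.sgn k = !s) :
    ∃ γ' : Clan p q, γ'.invol i = k ∧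
      (∀ a, a ≠ i → a ≠ k → γ'.invol a = γ.invol a ∧ γ'.sgn a = γ.sgn a) ∧
      (∀ t m, (γ'.rank t m : ℤ) = γ.rank t m - if t = s ∧ i.val < m ∧ m ≤ k.val then 1 else 0) ∧
      (∀ a b, a ≤ b → (γ'.rankJ a b : ℤ) = γ.rankJ a b +
        if i.val < a ∧ a ≤ k.val ∧ i.val < b ∧ b ≤ k.val then 1 else 0) := by
  have hd := γ.sgn_default
  have hi := γ.invol_invol
  obtain ⟨γ', hg, hs, hr, hJ⟩ := γ.exists_modify {i, k}
    (fun a => if a = i then k else if a = k then i else γ.invol a)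
    (fun a => if a = i then true else if a = k then true else γ.sgn a)
    (by grind) (by grind) (by simp; grind)
    (by
      rw [Finset.sum_insert (by grind), Finset.sum_singleton]
      simp only [signTerm]
      grind)
  have e1 : γ'.invol i = k := by grind
  have e2 : γ'.invol k = i := by grind
  refine ⟨γ', e1, by grind, ?_, ?_⟩
  · intro t m
    rw [hr, Finset.sum_insert (by grind), Finset.sum_singleton]
    simp only [rankTerm, e1, e2, h1, h2, s1, s2]
    clear hr hJ hg hs hd hi
    grind (splits := 40)
  · intro a b hab
    rw [hJ, Finset.sum_insert (by grind), Finset.sum_singleton]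
    simp only [e1, e2, h1, h2]
    clear hr hJ hg hs hd hi
    grind (splits := 40)

theorem exists_extend_right (γ : Clan p q) (s : Bool) {i j k : Fin (p + q)}
    (hij : i < j) (hjk : j < k) (h1 : γ.invol i = j) (h2 : γ.invol k = k) (s2 : γ.sgn k = s) :
    ∃ γ' : Clan p q, γ'.invol i = k ∧ γ'.invol j = j ∧ γ'.sgn j = s ∧
      (∀ a, a ≠ i → a ≠ j → a ≠ k → γ'.invol a = γ.invol a ∧ γ'.sgn a = γ.sgn a) ∧
      (∀ t m, (γ'.rank t m : ℤ) =
        γ.rank t m - if t = (!s) ∧ j.val < m ∧ m ≤ k.val then 1 else 0) ∧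
      (∀ a b, a ≤ b → (γ'.rankJ a b : ℤ) = γ.rankJ a b +
        if i.val < a ∧ a ≤ k.val ∧ j.val < b ∧ b ≤ k.val then 1 else 0) := by
  have h3 : γ.invol j = i := by rw [← h1, γ.invol_invol]
  have hd := γ.sgn_default
  have hi := γ.invol_invol
  obtain ⟨γ', hg, hs, hr, hJ⟩ := γ.exists_modify {i, j, k}
    (fun a => if a = i then k else if a = k then i else if a = j then j else γ.invol a)
    (fun a => if a = j then s else if a = k then true else γ.sgn a)
    (by grind) (by grind) (by simp; grind)
    (by
      rw [Finset.sum_insert (by grind), Finset.sum_insert (by grind), Finset.sum_singleton]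
      simp only [signTerm]
      grind)
  have e1 : γ'.invol i = k := by grind
  have e2 : γ'.invol j = j := by grind
  have e3 : γ'.invol k = i := by grind
  have s3 : γ'.sgn j = s := by grind
  refine ⟨γ', e1, e2, s3, by grind, ?_, ?_⟩
  · intro t m
    rw [hr, Finset.sum_insert (by grind), Finset.sum_insert (by grind), Finset.sum_singleton]
    simp only [rankTerm, e1, e2, e3, h1, h2, h3, s2, s3]
    clear hr hJ hg hs hd hi
    cases s <;> cases t <;> grind (splits := 40)
  · intro a b hab
    rw [hJ, Finset.sum_insert (by grind), Finset.sum_insert (by grind), Finset.sum_singleton]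
    simp only [e1, e2, e3, h1, h2, h3]
    clear hr hJ hg hs hd hi
    grind (splits := 40)

theorem exists_extend_left (γ : Clan p q) (s : Bool) {i j k : Fin (p + q)}
    (hij : i < j) (hjk : j < k) (h1 : γ.invol i = i) (s1 : γ.sgn i = s) (h2 : γ.invol j = k) :
    ∃ γ' : Clan p q, γ'.invol i = k ∧ γ'.invol j = j ∧ γ'.sgn j = s ∧
      (∀ a, a ≠ i → a ≠ j → a ≠ k → γ'.invol a = γ.invol a ∧ γ'.sgn a = γ.sgn a) ∧
      (∀ t m, (γ'.rank t m : ℤ) = γ.rank t m - if t = s ∧ i.val < m ∧ m ≤ j.val then 1 else 0) ∧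
      (∀ a b, a ≤ b → (γ'.rankJ a b : ℤ) = γ.rankJ a b +
        if i.val < a ∧ a ≤ j.val ∧ i.val < b ∧ b ≤ k.val then 1 else 0) := by
  have h3 : γ.invol k = j := by rw [← h2, γ.invol_invol]
  have hd := γ.sgn_default
  have hi := γ.invol_invol
  obtain ⟨γ', hg, hs, hr, hJ⟩ := γ.exists_modify {i, j, k}
    (fun a => if a = i then k else if a = k then i else if a = j then j else γ.invol a)
    (fun a => if a = j then s else if a = i then true else γ.sgn a)
    (by grind) (by grind) (by simp; grind)
    (by
      rw [Finset.sum_insert (by grind), Finset.sum_insert (by grind), Finset.sum_singleton]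
      simp only [signTerm]
      grind)
  have e1 : γ'.invol i = k := by grind
  have e2 : γ'.invol j = j := by grind
  have e3 : γ'.invol k = i := by grind
  have s3 : γ'.sgn j = s := by grind
  refine ⟨γ', e1, e2, s3, by grind, ?_, ?_⟩
  · intro t m
    rw [hr, Finset.sum_insert (by grind), Finset.sum_insert (by grind), Finset.sum_singleton]
    simp only [rankTerm, e1, e2, e3, h1, h2, h3, s1, s3]
    clear hr hJ hg hs hd hi
    grind (splits := 40)
  · intro a b hab
    rw [hJ, Finset.sum_insert (by grind), Finset.sum_insert (by grind), Finset.sum_singleton]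
    simp only [e1, e2, e3, h1, h2, h3]
    clear hr hJ hg hs hd hi
    grind (splits := 40)

theorem exists_cross_of_disjoint (γ : Clan p q) {i j k l : Fin (p + q)}
    (hij : i < j) (hjk : j < k) (hkl : k < l) (h1 : γ.invol i = j) (h2 : γ.invol k = l) :
    ∃ γ' : Clan p q, γ'.invol i = k ∧ γ'.invol j = l ∧
      (∀ a, a ≠ i → a ≠ j → a ≠ k → a ≠ l → γ'.invol a = γ.invol a) ∧
      (∀ a, γ'.sgn a = γ.sgn a) ∧
      (∀ t m, (γ'.rank t m : ℤ) = γ.rank t m - if j.val < m ∧ m ≤ k.val then 1 else 0) ∧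
      (∀ a b, a ≤ b → (γ'.rankJ a b : ℤ) = γ.rankJ a b +
        (if i.val < a ∧ j.val < b ∧ b ≤ k.val then 1 else 0) +
        (if j.val < a ∧ a ≤ k.val ∧ b ≤ l.val then 1 else 0)) := by
  have h3 : γ.invol j = i := by rw [← h1, γ.invol_invol]
  have h4 : γ.invol l = k := by rw [← h2, γ.invol_invol]
  have hd := γ.sgn_default
  have hi := γ.invol_invol
  obtain ⟨γ', hg, hs, hr, hJ⟩ := γ.exists_modify {i, j, k, l}
    (fun a => if a = i then k else if a = k then i else if a = j then l else
      if a = l then j else γ.invol a) γ.sgn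
    (by grind) (by grind) (by simp; grind)
    (by
      rw [Finset.sum_insert (by grind), Finset.sum_insert (by grind),
        Finset.sum_insert (by grind), Finset.sum_singleton]
      simp only [signTerm]
      grind)
  have e1 : γ'.invol i = k := by grind
  have e2 : γ'.invol j = l := by grind
  have e3 : γ'.invol k = i := by grind
  have e4 : γ'.invol l = j := by grind
  refine ⟨γ', e1, e2, by grind, hs, ?_, ?_⟩
  · intro t m
    rw [hr, Finset.sum_insert (by grind), Finset.sum_insert (by grind),
        Finset.sum_insert (by grind), Finset.sum_singleton]
    simp only [rankTerm, e1, e2, e3, e4, h1, h2, h3, h4]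
    clear hr hJ hg hs hd hi
    grind (splits := 40)
  · intro a b hab
    rw [hJ, Finset.sum_insert (by grind), Finset.sum_insert (by grind),
        Finset.sum_insert (by grind), Finset.sum_singleton]
    simp only [e1, e2, e3, e4, h1, h2, h3, h4]
    clear hr hJ hg hs hd hi
    grind (splits := 40)

theorem exists_nest_of_cross (γ : Clan p q) {i j k l : Fin (p + q)}
    (hij : i < j) (hjk : j < k) (hkl : k < l) (h1 : γ.invol i = k) (h2 : γ.invol j = l) :
    ∃ γ' : Clan p q, γ'.invol i = l ∧ γ'.invol j = k ∧
      (∀ a, a ≠ i → a ≠ j → a ≠ k → a ≠ l → γ'.invol a = γ.invol a) ∧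
      (∀ a, γ'.sgn a = γ.sgn a) ∧
      (∀ t m, (γ'.rank t m : ℤ) = γ.rank t m) ∧
      (∀ a b, a ≤ b → (γ'.rankJ a b : ℤ) = γ.rankJ a b +
        if i.val < a ∧ a ≤ j.val ∧ k.val < b ∧ b ≤ l.val then 1 else 0) := by
  have h3 : γ.invol k = i := by rw [← h1, γ.invol_invol]
  have h4 : γ.invol l = j := by rw [← h2, γ.invol_invol]
  have hd := γ.sgn_default
  have hi := γ.invol_invol
  obtain ⟨γ', hg, hs, hr, hJ⟩ := γ.exists_modify {i, j, k, l}
    (fun a => if a = i then l else if a = l then i else if a = j then k else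
      if a = k then j else γ.invol a) γ.sgn
    (by grind) (by grind) (by simp; grind)
    (by
      rw [Finset.sum_insert (by grind), Finset.sum_insert (by grind),
        Finset.sum_insert (by grind), Finset.sum_singleton]
      simp only [signTerm]
      grind)
  have e1 : γ'.invol i = l := by grind
  have e2 : γ'.invol j = k := by grind
  have e3 : γ'.invol k = j := by grind
  have e4 : γ'.invol l = i := by grind
  refine ⟨γ', e1, e2, by grind, hs, ?_, ?_⟩
  · intro t m
    rw [hr, Finset.sum_insert (by grind), Finset.sum_insert (by grind),
        Finset.sum_insert (by grind), Finset.sum_singleton]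
    simp only [rankTerm, e1, e2, e3, e4, h1, h2, h3, h4]
    clear hr hJ hg hs hd hi
    grind (splits := 40)
  · intro a b hab
    rw [hJ, Finset.sum_insert (by grind), Finset.sum_insert (by grind),
        Finset.sum_insert (by grind), Finset.sum_singleton]
    simp only [e1, e2, e3, e4, h1, h2, h3, h4]
    clear hr hJ hg hs hd hi
    grind (splits := 40)

theorem exists_split_of_pairs (γ : Clan p q) (s : Bool) {i j k l : Fin (p + q)}
    (hij : i < j) (hjk : j < k) (hkl : k < l) (h1 : γ.invol i = j) (h2 : γ.invol k = l) :
    ∃ γ' : Clan p q, γ'.invol i = l ∧ γ'.invol j = j ∧ γ'.sgn j = s ∧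
      γ'.invol k = k ∧ γ'.sgn k = !s ∧
      (∀ a, a ≠ i → a ≠ j → a ≠ k → a ≠ l → γ'.invol a = γ.invol a ∧ γ'.sgn a = γ.sgn a) ∧
      (∀ t m, (γ'.rank t m : ℤ) =
        γ.rank t m - if t = (!s) ∧ j.val < m ∧ m ≤ k.val then 1 else 0) ∧
      (∀ a b, a ≤ b → (γ'.rankJ a b : ℤ) = γ.rankJ a b +
        if i.val < a ∧ a ≤ k.val ∧ j.val < b ∧ b ≤ l.val then 1 else 0) := by
  have h3 : γ.invol j = i := by rw [← h1, γ.invol_invol]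
  have h4 : γ.invol l = k := by rw [← h2, γ.invol_invol]
  have hd := γ.sgn_default
  have hi := γ.invol_invol
  obtain ⟨γ', hg, hs, hr, hJ⟩ := γ.exists_modify {i, j, k, l}
    (fun a => if a = i then l else if a = l then i else if a = j then j else
      if a = k then k else γ.invol a)
    (fun a => if a = j then s else if a = k then !s else γ.sgn a)
    (by grind) (by grind) (by simp; grind)
    (by
      rw [Finset.sum_insert (by grind), Finset.sum_insert (by grind),
        Finset.sum_insert (by grind), Finset.sum_singleton]
      simp only [signTerm]
      grind)
  have e1 : γ'.invol i = l := by grind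
  have e2 : γ'.invol j = j := by grind
  have e3 : γ'.invol k = k := by grind
  have e4 : γ'.invol l = i := by grind
  have s2 : γ'.sgn j = s := by grind
  have s3 : γ'.sgn k = !s := by grind
  refine ⟨γ', e1, e2, s2, e3, s3, by grind, ?_, ?_⟩
  · intro t m
    rw [hr, Finset.sum_insert (by grind), Finset.sum_insert (by grind),
        Finset.sum_insert (by grind), Finset.sum_singleton]
    simp only [rankTerm, e1, e2, e3, e4, h1, h2, h3, h4, s2, s3]
    clear hr hJ hg hs hd hi
    grind (splits := 40)
  · intro a b hab
    rw [hJ, Finset.sum_insert (by grind), Finset.sum_insert (by grind),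
        Finset.sum_insert (by grind), Finset.sum_singleton]
    simp only [e1, e2, e3, e4, h1, h2, h3, h4]
    clear hr hJ hg hs hd hi
    grind (splits := 40)

/-- The closing ends of 2-cycles are as numerous as the opening ends. -/
theorem card_open_lt (γ : Clan p q) (i : ℕ) :
    ((Finset.univ : Finset (Fin (p + q))).filter
      (fun a => a.val < (γ.invol a).val ∧ (γ.invol a).val < i)).card =
    ((Finset.univ : Finset (Fin (p + q))).filter
      (fun a => (γ.invol a).val < a.val ∧ a.val < i)).card := by
  refine Finset.card_bij (fun a _ => γ.invol a) ?_ (fun a _ b _ h => γ.invol.injective h) ?_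
  · intro a ha
    simpa [γ.invol_invol] using ha
  · intro b hb
    exact ⟨γ.invol b, by simpa [γ.invol_invol] using hb, γ.invol_invol b⟩

theorem rank_eq_card (γ : Clan p q) (s : Bool) (i : ℕ) :
    γ.rank s i = ((Finset.univ : Finset (Fin (p + q))).filter (fun a => a.val < i ∧
      ((γ.invol a = a ∧ γ.sgn a = s) ∨ γ.invol a < a))).card := by
  rw [rank, card_open_lt, ← Finset.card_union_of_disjoint]
  · congr 1
    ext a
    simp only [Finset.mem_union, Finset.mem_filter, Finset.mem_univ, true_and, Fin.lt_def]
    tauto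
  · rw [Finset.disjoint_filter]
    rintro a - ⟨h, -⟩ ⟨h', -⟩
    rw [h] at h'
    exact lt_irrefl _ h'

theorem rank_split (γ : Clan p q) (s : Bool) {u v : ℕ} (huv : u ≤ v) :
    γ.rank s v = γ.rank s u + ((Finset.univ : Finset (Fin (p + q))).filter (fun a =>
      (u ≤ a.val ∧ a.val < v) ∧ ((γ.invol a = a ∧ γ.sgn a = s) ∨ γ.invol a < a))).card := by
  rw [rank_eq_card, rank_eq_card, ← Finset.card_union_of_disjoint]
  · congr 1
    ext a
    simp only [Finset.mem_union, Finset.mem_filter, Finset.mem_univ, true_and]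
    have : a.val < v ↔ a.val < u ∨ (u ≤ a.val ∧ a.val < v) := by omega
    tauto
  · rw [Finset.disjoint_filter]
    intro a _ h h'
    omega

theorem rankJ_split (γ : Clan p q) (a : ℕ) {b c : ℕ} (hbc : b ≤ c) :
    γ.rankJ a b = γ.rankJ a c + ((Finset.univ : Finset (Fin (p + q))).filter (fun x =>
      x.val < a ∧ b ≤ (γ.invol x).val ∧ (γ.invol x).val < c)).card := by
  rw [rankJ, rankJ, ← Finset.card_union_of_disjoint]
  · congr 1
    ext x
    simp only [Finset.mem_union, Finset.mem_filter, Finset.mem_univ, true_and]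
    omega
  · rw [Finset.disjoint_filter]
    intro a _ h h'
    omega

theorem rankJ_split_left (γ : Clan p q) {a b : ℕ} (c : ℕ) (hab : a ≤ b) :
    γ.rankJ b c = γ.rankJ a c + ((Finset.univ : Finset (Fin (p + q))).filter (fun x =>
      (a ≤ x.val ∧ x.val < b) ∧ c ≤ (γ.invol x).val)).card := by
  rw [rankJ, rankJ, ← Finset.card_union_of_disjoint]
  · congr 1
    ext x
    simp only [Finset.mem_union, Finset.mem_filter, Finset.mem_univ, true_and]
    omega
  · rw [Finset.disjoint_filter]
    intro a _ h h'
    omega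

theorem rankJ_add_card (γ : Clan p q) {a : ℕ} (b : ℕ) (ha : a ≤ p + q) :
    γ.rankJ a b + ((Finset.univ : Finset (Fin (p + q))).filter (fun x =>
      x.val < a ∧ (γ.invol x).val < b)).card = a := by
  conv_rhs => rw [← min_eq_right ha, ← Fin.card_filter_val_lt]
  rw [rankJ, ← Finset.card_union_of_disjoint]
  · congr 1
    ext x
    simp only [Finset.mem_union, Finset.mem_filter, Finset.mem_univ, true_and]
    omega
  · rw [Finset.disjoint_filter]
    intro a _ h h'
    omega

theorem rankJ_swap (γ : Clan p q) {a b : ℕ} (ha : a ≤ p + q) (hb : b ≤ p + q) :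
    γ.rankJ b a + a = γ.rankJ a b + b := by
  have h1 := γ.rankJ_add_card b ha
  have h2 := γ.rankJ_add_card a hb
  have h3 : ((Finset.univ : Finset (Fin (p + q))).filter (fun x =>
      x.val < a ∧ (γ.invol x).val < b)).card =
      ((Finset.univ : Finset (Fin (p + q))).filter (fun x =>
      x.val < b ∧ (γ.invol x).val < a)).card := by
    refine Finset.card_bij (fun a _ => γ.invol a) ?_ (fun a _ b _ h => γ.invol.injective h) ?_
    · intro a ha
      simpa [γ.invol_invol, and_comm] using ha
    · intro b hb
      exact ⟨γ.invol b, by simpa [γ.invol_invol, and_comm] using hb, γ.invol_invol b⟩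
  omega

theorem rank_add_rank_add_rankJ (γ : Clan p q) {i : ℕ} (hi : i ≤ p + q) (s : Bool) :
    γ.rank s i + γ.rank (!s) i + γ.rankJ i i = i := by
  have h := γ.rankJ_add_card i hi
  have h2 : γ.rank s i + γ.rank (!s) i = ((Finset.univ : Finset (Fin (p + q))).filter (fun x =>
      x.val < i ∧ (γ.invol x).val < i)).card := by
    rw [γ.rank_eq_card (!s), rank]
    simp only [Finset.card_filter, ← Finset.sum_add_distrib]
    refine Finset.sum_congr rfl fun x _ => ?_
    rcases lt_trichotomy (γ.invol x) x with hx | hx | hx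
    · have := Fin.lt_def.1 hx
      simp only [hx, hx.ne, false_and, or_true, and_true, if_false, zero_add]
      grind
    · simp only [hx, lt_irrefl]
      cases s <;> cases γ.sgn x <;> grind
    · have := Fin.lt_def.1 hx
      simp only [hx.ne', hx.not_gt, false_and, or_false, and_false, if_false, zero_add, this,
        true_and, add_zero]
      grind
  omega

theorem rank_le_of_le {γ τ : Clan p q} (h : le γ τ) (s : Bool) (i : ℕ) :
    τ.rank s i ≤ γ.rank s i := by
  cases s
  · exact h.2.1 i
  · exact h.1 i

theorem rankJ_le_of_le {γ τ : Clan p q} (h : le γ τ) {a b : ℕ} (ha : a ≤ p + q) (hb : b ≤ p + q) :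
    γ.rankJ a b ≤ τ.rankJ a b := by
  rcases lt_trichotomy a b with hab | rfl | hab
  · exact h.2.2 a b hab
  · have := γ.rank_add_rank_add_rankJ ha true
    have := τ.rank_add_rank_add_rankJ ha true
    have := rank_le_of_le h true a
    have := rank_le_of_le h (!true) a
    omega
  · have := γ.rankJ_swap ha hb
    have := τ.rankJ_swap ha hb
    have := h.2.2 b a hab
    omega

theorem exists_of_move {γ γ' τ : Clan p q} {f : Fin (p + q)} (hmove : IsMove γ γ')
    (hf : γ'.invol f ≠ γ.invol f)
    (hr : ∀ s m, γ'.rank s m ≤ γ.rank s m ∧ τ.rank s m ≤ γ'.rank s m)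
    (hJ : ∀ a b, a < b → γ.rankJ a b ≤ γ'.rankJ a b ∧ γ'.rankJ a b ≤ τ.rankJ a b) :
    ∃ γ' : Clan p q, Clan.lt γ γ' ∧ Clan.le γ' τ ∧ IsMove γ γ' :=
  ⟨γ', ⟨⟨fun i => (hr true i).1, fun i => (hr false i).1, fun a b hab => (hJ a b hab).1⟩,
    fun h => hf (by rw [h])⟩,
    ⟨fun i => (hr true i).2, fun i => (hr false i).2, fun a b hab => (hJ a b hab).2⟩, hmove⟩

/-- `f` is the first position at which `γ ≤ τ` differ, and there `f ≤ γ f < τ f = d`. -/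
structure FirstDiff (γ τ : Clan p q) (f d : Fin (p + q)) : Prop where
  le : Clan.le γ τ
  common : ∀ x, x < f → γ.invol x = τ.invol x
  rank_eq : ∀ s, τ.rank s f.val = γ.rank s f.val
  invol_f : τ.invol f = d
  f_le : f ≤ γ.invol f
  lt_d : γ.invol f < d

theorem exists_firstDiff {γ τ : Clan p q} (h : lt γ τ) : ∃ f d, FirstDiff γ τ f d := by
  obtain ⟨hle, hne⟩ := h
  have hex : ∃ m : ℕ, ∃ x : Fin (p + q), x.val = m ∧
      (γ.invol x ≠ τ.invol x ∨ γ.sgn x ≠ τ.sgn x) := by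
    by_contra hcon
    push Not at hcon
    apply hne
    have h1 : γ.invol = τ.invol := Equiv.ext fun x => (hcon _ x rfl).1
    have h2 : γ.sgn = τ.sgn := funext fun x => (hcon _ x rfl).2
    cases γ
    cases τ
    simp_all
  classical
  obtain ⟨f, hf, hdiff⟩ := Nat.find_spec hex
  have hmin : ∀ x, x < f → γ.invol x = τ.invol x ∧ γ.sgn x = τ.sgn x := by
    intro x hx
    have := Nat.find_min hex (m := x.val) (by rw [← hf]; exact hx)
    push Not at this
    exact this x rfl
  have hγ : f ≤ γ.invol f := by
    by_contra hlt
    push Not at hlt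
    have h1 := (hmin _ hlt).1
    rw [γ.invol_invol] at h1
    have h2 : τ.invol f = γ.invol f := by rw [h1, τ.invol_invol, ← h1]
    have := γ.sgn_default f hlt.ne
    have := τ.sgn_default f (by rw [h2]; exact hlt.ne)
    grind
  have hτ : f ≤ τ.invol f := by
    by_contra hlt
    push Not at hlt
    have h1 := (hmin _ hlt).1
    rw [τ.invol_invol] at h1
    have h2 : γ.invol f = τ.invol f := by rw [← h1, γ.invol_invol, h1]
    have := τ.sgn_default f hlt.ne
    have := γ.sgn_default f (by rw [h2]; exact hlt.ne)
    grind
  have hrank : ∀ s, τ.rank s f.val = γ.rank s f.val := by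
    intro s
    rw [rank_eq_card, rank_eq_card]
    congr 1
    ext x
    simp only [Finset.mem_filter, Finset.mem_univ, true_and]
    refine and_congr_right fun hx => ?_
    rw [(hmin x hx).1, (hmin x hx).2]
  have hstep : ∀ (c : Clan p q) (s : Bool), f ≤ c.invol f → c.rank s (f.val + 1) =
      c.rank s f.val + if c.invol f = f ∧ c.sgn f = s then 1 else 0 := by
    intro c s hc
    rw [c.rank_split s (Nat.le_succ f.val)]
    congr 1
    split_ifs with hs
    · rw [Finset.card_eq_one]
      refine ⟨f, ?_⟩
      ext x
      simp only [Finset.mem_filter, Finset.mem_univ, true_and, Finset.mem_singleton]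
      constructor
      · rintro ⟨hx, -⟩
        exact Fin.ext (by omega)
      · rintro rfl
        exact ⟨by omega, Or.inl hs⟩
    · rw [Finset.card_eq_zero, Finset.filter_eq_empty_iff]
      rintro x - ⟨hx, hx'⟩
      obtain rfl : x = f := Fin.ext (by omega)
      rcases hx' with hx' | hx'
      · exact hs hx'
      · exact absurd hx' hc.not_gt
  have hτ' : f < τ.invol f := by
    refine lt_of_le_of_ne hτ fun heq => ?_
    have h1 := hstep γ (τ.sgn f) hγ
    have h2 := hstep τ (τ.sgn f) hτ
    have h3 := hrank (τ.sgn f)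
    have h4 := rank_le_of_le hle (τ.sgn f) (f.val + 1)
    rw [if_pos ⟨heq.symm, rfl⟩] at h2
    split_ifs at h1 with hs
    · rcases hdiff with h | h
      · exact h (hs.1.trans heq)
      · exact h hs.2
    · omega
  refine ⟨f, τ.invol f, hle, fun x hx => (hmin x hx).1, hrank, rfl, hγ, ?_⟩
  by_contra hcon
  push Not at hcon
  rcases hcon.eq_or_lt with heq | hlt
  · have := τ.sgn_default f hτ'.ne'
    have := γ.sgn_default f (by rw [← heq]; exact hτ'.ne')
    grind
  · have hJ := hle.2.2 (f.val + 1) (γ.invol f).val (by have := Fin.lt_def.1 hτ'; omega)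
    refine absurd hJ (not_le.2 ?_)
    refine Finset.card_lt_card ((Finset.ssubset_iff_of_subset ?_).2 ⟨f, ?_, ?_⟩)
    · intro x hx
      simp only [Finset.mem_filter, Finset.mem_univ, true_and] at hx ⊢
      have hxf : x ≠ f := by
        rintro rfl
        exact absurd hx.2 (by simpa using hlt)
      have : x < f := lt_of_le_of_ne (Fin.le_def.2 (by omega)) hxf
      rw [(hmin x this).1]
      exact hx
    · simp
    · simpa using hlt

namespace FirstDiff

variable {γ τ : Clan p q} {f d : Fin (p + q)}

theorem invol_d (H : FirstDiff γ τ f d) : τ.invol d = f := by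
  rw [← H.invol_f, τ.invol_invol]

theorem f_lt_d (H : FirstDiff γ τ f d) : f < d := H.f_le.trans_lt H.lt_d

theorem rankJ_lt (H : FirstDiff γ τ f d) {a b : ℕ} (ha : f.val < a) (ha' : a ≤ p + q)
    (hb : (γ.invol f).val < b) (hb' : b ≤ d.val)
    (hx : ∀ x : Fin (p + q), f < x → x.val < a → b ≤ (γ.invol x).val → d < γ.invol x) :
    γ.rankJ a b < τ.rankJ a b := by
  rw [γ.rankJ_split a (Nat.le_succ_of_le hb'), τ.rankJ_split a (Nat.le_succ_of_le hb')]
  refine add_lt_add_of_le_of_lt (rankJ_le_of_le H.le ha' (by omega)) ?_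
  refine Finset.card_lt_card ((Finset.ssubset_iff_of_subset ?_).2 ⟨f, ?_, ?_⟩)
  · intro x h
    simp only [Finset.mem_filter, Finset.mem_univ, true_and] at h ⊢
    have hxf : x < f := by
      by_contra hcon
      rcases (not_lt.1 hcon).eq_or_lt with rfl | hlt
      · omega
      · have := Fin.lt_def.1 (hx x hlt h.1 h.2.1)
        omega
    rw [← H.common x hxf]
    exact h
  · have := H.f_lt_d
    simp only [Finset.mem_filter, Finset.mem_univ, true_and, H.invol_f]
    omega
  · simp only [Finset.mem_filter, Finset.mem_univ, true_and]
    omega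

theorem invol_eq_of_invol_lt (H : FirstDiff γ τ f d) {y : Fin (p + q)} (h : γ.invol y < f) :
    τ.invol y = γ.invol y := by
  have h1 := H.common _ h
  rw [γ.invol_invol] at h1
  rw [h1, τ.invol_invol, ← h1]

theorem not_invol_d_lt (H : FirstDiff γ τ f d) : ¬ γ.invol d < f := by
  intro h
  have h1 := H.invol_eq_of_invol_lt h
  rw [H.invol_d] at h1
  exact h.ne h1.symm

theorem rank_mono (H : FirstDiff γ τ f d) (s : Bool) {u v : ℕ} (huv : u ≤ v)
    (hy : ∀ y : Fin (p + q), u ≤ y.val → y.val < v →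
      ¬ (γ.invol y = y ∧ γ.sgn y = s) ∧ (γ.invol y < y → γ.invol y < f)) :
    γ.rank s v + τ.rank s u ≤ γ.rank s u + τ.rank s v := by
  have := γ.rank_split s huv
  have := τ.rank_split s huv
  have : _ ≤ ((Finset.univ : Finset (Fin (p + q))).filter (fun a =>
      (u ≤ a.val ∧ a.val < v) ∧ ((τ.invol a = a ∧ τ.sgn a = s) ∨ τ.invol a < a))).card :=
    Finset.card_le_card (s := (Finset.univ : Finset (Fin (p + q))).filter (fun a =>
      (u ≤ a.val ∧ a.val < v) ∧ ((γ.invol a = a ∧ γ.sgn a = s) ∨ γ.invol a < a))) (by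
      intro y h
      simp only [Finset.mem_filter, Finset.mem_univ, true_and] at h ⊢
      obtain ⟨h1, h2⟩ := hy y h.1.1 h.1.2
      have h3 : γ.invol y < y := h.2.resolve_left h1
      rw [H.invol_eq_of_invol_lt (h2 h3)]
      exact ⟨h.1, Or.inr h3⟩)
  omega

theorem rank_mono_strict (H : FirstDiff γ τ f d) (s : Bool) {u : ℕ} (hu : u ≤ d.val)
    (hy : ∀ y : Fin (p + q), u ≤ y.val → y ≤ d →
      ¬ (γ.invol y = y ∧ γ.sgn y = s) ∧ (γ.invol y < y → γ.invol y < f)) :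
    γ.rank s (d.val + 1) + τ.rank s u < γ.rank s u + τ.rank s (d.val + 1) := by
  have hu' : u ≤ d.val + 1 := by omega
  have := γ.rank_split s hu'
  have := τ.rank_split s hu'
  have : _ < ((Finset.univ : Finset (Fin (p + q))).filter (fun a =>
      (u ≤ a.val ∧ a.val < d.val + 1) ∧
        ((τ.invol a = a ∧ τ.sgn a = s) ∨ τ.invol a < a))).card :=
    Finset.card_lt_card (s := (Finset.univ : Finset (Fin (p + q))).filter (fun a =>
      (u ≤ a.val ∧ a.val < d.val + 1) ∧
        ((γ.invol a = a ∧ γ.sgn a = s) ∨ γ.invol a < a)))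
    ((Finset.ssubset_iff_of_subset (by
      intro y h
      simp only [Finset.mem_filter, Finset.mem_univ, true_and] at h ⊢
      obtain ⟨h1, h2⟩ := hy y h.1.1 (Fin.le_def.2 (by omega))
      have h3 : γ.invol y < y := h.2.resolve_left h1
      rw [H.invol_eq_of_invol_lt (h2 h3)]
      exact ⟨h.1, Or.inr h3⟩)).2 ⟨d, by
        have := H.f_lt_d
        simp only [Finset.mem_filter, Finset.mem_univ, true_and, H.invol_d]
        exact ⟨by omega, Or.inr this⟩, by
        simp only [Finset.mem_filter, Finset.mem_univ, true_and]
        rintro ⟨-, h⟩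
        obtain ⟨h1, h2⟩ := hy d hu le_rfl
        exact H.not_invol_d_lt (h2 (h.resolve_left h1))⟩)
  omega

/-- If no 2-cycle starting strictly between `f` and `γ f` can be nested with `{f, γ f}` below `τ`,
then up to the first 2-cycle inside `(γ f, d]` every closing end belongs to a 2-cycle
shared with `τ`. -/
theorem invol_lt_f (H : FirstDiff γ τ f d)
    (hC : ∀ x, f < x → x < γ.invol f → γ.invol f < γ.invol x → d < γ.invol x)
    {y : Fin (p + q)} (hjy : γ.invol f < y) (hyd : y ≤ d) (hy : γ.invol y < y)
    (hmin : ∀ x, γ.invol f < x → x < y → x ≤ γ.invol x → γ.invol x ≤ d → γ.invol x = x) :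
    γ.invol y < f := by
  have hinv := γ.invol_invol
  by_contra hcon
  rcases (not_lt.1 hcon).eq_or_lt with h | h
  · rw [h, hinv] at hjy
    exact lt_irrefl _ hjy
  · rcases lt_trichotomy (γ.invol y) (γ.invol f) with h1 | h1 | h1
    · have := hC _ h h1 (by rwa [hinv])
      rw [hinv] at this
      exact this.not_ge hyd
    · have : y = f := γ.invol.injective h1
      rw [this] at hjy
      exact hjy.not_ge H.f_le
    · have := hmin _ h1 hy (by rw [hinv]; exact hy.le) (by rwa [hinv])
      rw [hinv] at this
      exact hy.ne this.symm

/-- The moves `11* → 1*1`, `*11 → 1*1`, `1122 → 1±∓1` and `±∓ → 11`, performed at `f` and the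
first suitable position `k` in `(γ f, d]`. -/
theorem exists_move_at (H : FirstDiff γ τ f d) (s : Bool)
    (hC : ∀ x, f < x → x < γ.invol f → γ.invol f < γ.invol x → d < γ.invol x)
    (hf : γ.invol f = f → γ.sgn f = s) {k : Fin (p + q)} (hjk : γ.invol f < k)
    (hk : k ≤ γ.invol k) (hkd : γ.invol k ≤ d) (hks : ¬ (γ.invol k = k ∧ γ.sgn k = s))
    (hmin : ∀ x, γ.invol f < x → x < k → x ≤ γ.invol x → γ.invol x ≤ d → γ.invol x = x)
    (hD : ∀ m : ℕ, (γ.invol f).val < m → m ≤ k.val → τ.rank s m < γ.rank s m) :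
    ∃ γ' : Clan p q, Clan.lt γ γ' ∧ Clan.le γ' τ ∧ IsMove γ γ' := by
  have hfj := H.f_le
  have hJ : ∀ a b : ℕ, a ≤ b → f.val < a → a ≤ k.val → (γ.invol f).val < b →
      b ≤ (γ.invol k).val → γ.rankJ a b < τ.rankJ a b := by
    intro a b hab h1 h2 h3 h4
    refine H.rankJ_lt h1 (by omega) h3 (h4.trans hkd) fun x hfx hxa hbx => ?_
    rcases lt_trichotomy x (γ.invol f) with h | h | h
    · exact hC x hfx h (Fin.lt_def.2 (by omega))
    · rw [h, γ.invol_invol] at hbx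
      omega
    · by_contra hcon
      have := hmin x h (Fin.lt_def.2 (by omega)) (Fin.le_def.2 (by omega)) (not_lt.1 hcon)
      rw [this] at hbx
      omega
  have hrank := rank_le_of_le H.le
  have hrankJ := H.le.2.2
  have finish : ∀ γ' : Clan p q, IsMove γ γ' → γ'.invol f = γ.invol k →
      (∀ t m, (γ'.rank t m : ℤ) =
        γ.rank t m - if t = s ∧ (γ.invol f).val < m ∧ m ≤ k.val then 1 else 0) →
      (∀ a b, a ≤ b → (γ'.rankJ a b : ℤ) = γ.rankJ a b +
        if f.val < a ∧ a ≤ k.val ∧ (γ.invol f).val < b ∧ b ≤ (γ.invol k).val then 1 else 0) →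
      ∃ γ' : Clan p q, Clan.lt γ γ' ∧ Clan.le γ' τ ∧ IsMove γ γ' := by
    intro γ' hm he hr hrJ
    refine exists_of_move (f := f) hm (by rw [he]; exact (hjk.trans_le hk).ne') ?_ ?_
    · intro t m
      have h1 := hr t m
      have h2 := hrank t m
      split_ifs at h1 with h
      · have := hD m h.2.1 h.2.2
        rw [h.1] at h1 ⊢
        omega
      · omega
    · intro a b hab
      have h1 := hrJ a b hab.le
      have h2 := hrankJ a b hab
      split_ifs at h1 with h
      · have := hJ a b hab.le h.1 h.2.1 h.2.2.1 h.2.2.2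
        omega
      · omega
  rcases hk.eq_or_lt with hkk | hkk
  · have hks' : γ.sgn k = !s := by
      have := fun h => hks ⟨hkk.symm, h⟩
      cases s <;> simpa using this
    rcases hfj.eq_or_lt with hff | hff
    · obtain ⟨γ', h1, h2, h3, h4⟩ := γ.exists_pair_of_fixed s (hff.trans_lt hjk) hff.symm
        (hf hff.symm) hkk.symm hks'
      refine finish γ' ?_ (by rw [h1, ← hkk]) (by rw [← hff]; exact h3)
        (by rw [← hff, ← hkk]; exact h4)
      cases s
      · exact Or.inr (Or.inl ⟨f, k, hff.trans_lt hjk, hff.symm, hf hff.symm, hkk.symm, hks',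
          h1, h2⟩)
      · exact Or.inl ⟨f, k, hff.trans_lt hjk, hff.symm, hf hff.symm, hkk.symm, hks', h1, h2⟩
    · obtain ⟨γ', h1, h2, h3, h4, h5, h6⟩ := γ.exists_extend_right (!s) hff hjk rfl hkk.symm hks'
      refine finish γ' ?_ (by rw [h1, ← hkk]) (by simpa using h5) (by rw [← hkk]; exact h6)
      cases s
      · exact Or.inr (Or.inr (Or.inl ⟨f, _, k, hff, hjk, rfl, hkk.symm, hks', h1, h2, h3, h4⟩))
      · exact Or.inr (Or.inr (Or.inr (Or.inl
          ⟨f, _, k, hff, hjk, rfl, hkk.symm, hks', h1, h2, h3, h4⟩)))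
  · rcases hfj.eq_or_lt with hff | hff
    · obtain ⟨γ', h1, h2, h3, h4, h5, h6⟩ := γ.exists_extend_left s (hff.trans_lt hjk) hkk
        hff.symm (hf hff.symm) rfl
      refine finish γ' ?_ h1 (by rw [← hff]; exact h5) (by rw [← hff]; exact h6)
      cases s
      · exact Or.inr (Or.inr (Or.inr (Or.inr (Or.inr (Or.inl
          ⟨f, k, _, hff.trans_lt hjk, hkk, hff.symm, hf hff.symm, rfl, h1, h2, h3, h4⟩)))))
      · exact Or.inr (Or.inr (Or.inr (Or.inr (Or.inl
          ⟨f, k, _, hff.trans_lt hjk, hkk, hff.symm, hf hff.symm, rfl, h1, h2, h3, h4⟩))))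
    · obtain ⟨γ', h1, h2, h3, h4, h5, h6, h7, h8⟩ := γ.exists_split_of_pairs (!s) hff hjk hkk
        rfl rfl
      refine finish γ' ?_ h1 (by simpa using h7) h8
      cases s
      · exact Or.inr (Or.inr (Or.inr (Or.inr (Or.inr (Or.inr (Or.inr (Or.inl
          ⟨f, _, k, _, hff, hjk, hkk, rfl, rfl, h1, h2, h3, h4, h5, h6⟩)))))))
      · exact Or.inr (Or.inr (Or.inr (Or.inr (Or.inr (Or.inr (Or.inr (Or.inr (Or.inl
          ⟨f, _, k, _, hff, hjk, hkk, rfl, rfl, h1, h2, h3, h4, h5, h6⟩))))))))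

/-- If the ranks of sign `!s` at `u` leave no room, a move at the first position of `(γ f, d]`
behaving differently from an `s`-signed fixed point stays below `τ`. -/
theorem exists_move_of_rank_eq (H : FirstDiff γ τ f d) (s : Bool)
    (hC : ∀ x, f < x → x < γ.invol f → γ.invol f < γ.invol x → d < γ.invol x)
    (hf : γ.invol f = f → γ.sgn f = s) {u : ℕ} (hu : (γ.invol f).val < u) (hud : u ≤ d.val)
    (hmin : ∀ x : Fin (p + q), γ.invol f < x → x.val < u → x ≤ γ.invol x → d < γ.invol x)
    (hD : γ.rank (!s) u ≤ τ.rank (!s) u) :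
    ∃ γ' : Clan p q, Clan.lt γ γ' ∧ Clan.le γ' τ ∧ IsMove γ γ' := by
  have hfj := H.f_le
  have hex : ∃ k : ℕ, ∃ x : Fin (p + q), x.val = k ∧ γ.invol f < x ∧ x ≤ γ.invol x ∧
      γ.invol x ≤ d ∧ ¬ (γ.invol x = x ∧ γ.sgn x = s) := by
    by_contra hcon
    push Not at hcon
    have hfix : ∀ x, γ.invol f < x → x ≤ γ.invol x → γ.invol x ≤ d →
        γ.invol x = x ∧ γ.sgn x = s := fun x h1 h2 h3 => hcon _ x rfl h1 h2 h3
    have h1 := H.rank_mono_strict (!s) hud fun y huy hyd =>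
      have hjy : γ.invol f < y := Fin.lt_def.2 (by omega)
      ⟨fun ⟨h1, h2⟩ => by
        have := (hfix y hjy h1.ge (by rw [h1]; exact hyd)).2
        rw [this] at h2
        cases s <;> simp at h2,
      fun hy => H.invol_lt_f hC hjy hyd hy fun x h1 _ h2 h3 => (hfix x h1 h2 h3).1⟩
    have h2 := rank_le_of_le H.le (!s) (d.val + 1)
    omega
  classical
  obtain ⟨k, hk, hjk, hkk, hkd, hks⟩ := Nat.find_spec hex
  have hfix : ∀ x, γ.invol f < x → x < k → x ≤ γ.invol x → γ.invol x ≤ d →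
      γ.invol x = x ∧ γ.sgn x = s := by
    intro x h1 h2 h3 h4
    have := Nat.find_min hex (m := x.val) (by rw [← hk]; exact h2)
    push Not at this
    exact this x rfl h1 h3 h4
  have huk : u ≤ k.val := by
    by_contra hcon
    exact (hmin k hjk (by omega) hkk).not_ge hkd
  have hclose : ∀ y, γ.invol f < y → y < k → γ.invol y < y → γ.invol y < f :=
    fun y h1 h2 h3 => H.invol_lt_f hC h1 (h2.le.trans (hkk.trans hkd)) h3
      fun x h4 h5 h6 h7 => (hfix x h4 (h5.trans h2) h6 h7).1
  refine H.exists_move_at s hC hf hjk hkk hkd hks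
    (fun x h1 h2 h3 h4 => (hfix x h1 h2 h3 h4).1) ?_
  have hge : ∀ m : ℕ, u ≤ m → m ≤ k.val → τ.rank s m < γ.rank s m := by
    intro m hum hmk
    have h1 := H.rank_mono (!s) hum fun y huy hym =>
      have hjy : γ.invol f < y := Fin.lt_def.2 (by omega)
      have hyk : y < k := Fin.lt_def.2 (by omega)
      ⟨fun ⟨h1, h2⟩ => by
        have := (hfix y hjy hyk h1.ge (by rw [h1]; exact hyk.le.trans (hkk.trans hkd))).2
        rw [this] at h2
        cases s <;> simp at h2,
      hclose y hjy hyk⟩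
    have hmn : m ≤ p + q := by omega
    have hkd' := Fin.le_def.1 hkd
    have hkk' := Fin.le_def.1 hkk
    have h2 := γ.rank_add_rank_add_rankJ hmn s
    have h3 := τ.rank_add_rank_add_rankJ hmn s
    have h4 : γ.rankJ m m < τ.rankJ m m := by
      refine H.rankJ_lt (by omega) hmn (by omega) (by omega) fun x hfx hxm hmx => ?_
      have hxx : x < γ.invol x := Fin.lt_def.2 (by omega)
      rcases lt_trichotomy x (γ.invol f) with h | h | h
      · exact hC x hfx h (Fin.lt_def.2 (by omega))
      · rw [h, γ.invol_invol] at hmx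
        omega
      · by_contra hcon
        exact hxx.ne' (hfix x h (Fin.lt_def.2 (by omega)) hxx.le (not_lt.1 hcon)).1
    omega
  intro m hjm hmk
  rcases le_total u m with h | h
  · exact hge m h hmk
  · have h1 := H.rank_mono s h fun y hmy hyu =>
      have hjy : γ.invol f < y := Fin.lt_def.2 (by omega)
      have hyk : y < k := Fin.lt_def.2 (by omega)
      ⟨fun ⟨h1, _⟩ => by
        have := hmin y hjy hyu h1.ge
        rw [h1] at this
        omega,
      hclose y hjy hyk⟩
    have := hge u le_rfl huk
    omega

/-- The move `1212 → 1221` at `f`. -/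
theorem exists_move_of_cross (H : FirstDiff γ τ f d)
    (h : ∃ x, f < x ∧ x < γ.invol f ∧ γ.invol f < γ.invol x ∧ γ.invol x ≤ d) :
    ∃ γ' : Clan p q, Clan.lt γ γ' ∧ Clan.le γ' τ ∧ IsMove γ γ' := by
  have hex : ∃ m : ℕ, ∃ x : Fin (p + q), x.val = m ∧
      f < x ∧ x < γ.invol f ∧ γ.invol f < γ.invol x ∧ γ.invol x ≤ d := by
    obtain ⟨x, hx⟩ := h
    exact ⟨_, x, rfl, hx⟩
  classical
  obtain ⟨x, hx, hfx, hxj, hjx, hxd⟩ := Nat.find_spec hex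
  have hmin : ∀ y, f < y → y < x → γ.invol f < γ.invol y → d < γ.invol y := by
    intro y h1 h2 h3
    by_contra hcon
    exact Nat.find_min hex (m := y.val) (by rw [← hx]; exact h2)
      ⟨y, rfl, h1, h2.trans hxj, h3, not_lt.1 hcon⟩
  obtain ⟨γ', h1, h2, h3, h4, h5, h6⟩ := γ.exists_nest_of_cross hfx hxj hjx rfl rfl
  have hrank := rank_le_of_le H.le
  refine exists_of_move (f := f) ?_ (by rw [h1]; exact hjx.ne') ?_ ?_
  · exact Or.inr (Or.inr (Or.inr (Or.inr (Or.inr (Or.inr (Or.inr (Or.inr (Or.inr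
      ⟨f, x, _, _, hfx, hxj, hjx, rfl, rfl, h1, h2, h3, h4⟩))))))))
  · intro t m
    have := h5 t m
    have := hrank t m
    omega
  · intro a b hab
    have hJ := h6 a b hab.le
    have hle := H.le.2.2 a b hab
    split_ifs at hJ with hr
    · have : γ.rankJ a b < τ.rankJ a b :=
        H.rankJ_lt hr.1 (by omega) hr.2.2.1 (hr.2.2.2.trans hxd) fun y hfy hya hby =>
          hmin y hfy (Fin.lt_def.2 (by omega)) (Fin.lt_def.2 (by omega))
      omega
    · omega

/-- The move `1122 → 1212` at `f`. -/
theorem exists_move_of_forall_lt (H : FirstDiff γ τ f d) (hfj : f < γ.invol f)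
    (hC : ∀ x, f < x → x < γ.invol f → γ.invol f < γ.invol x → d < γ.invol x)
    (hN : ∀ x, γ.invol f < x → x ≤ γ.invol x → d < γ.invol x) :
    ∃ γ' : Clan p q, Clan.lt γ γ' ∧ Clan.le γ' τ ∧ IsMove γ γ' := by
  have hclose : ∀ y, γ.invol f < y → y ≤ d → γ.invol y < y → γ.invol y < f :=
    fun y h1 h2 h3 => H.invol_lt_f hC h1 h2 h3 fun x h4 _ h6 h7 => absurd h7 (hN x h4 h6).not_ge
  have hfix : ∀ y, γ.invol f < y → y ≤ d → γ.invol y ≠ y :=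
    fun y h1 h2 h3 => (hN y h1 h3.ge).not_ge (h3.le.trans h2)
  have hdd : d < γ.invol d :=
    hN d H.lt_d (not_lt.1 fun h => H.not_invol_d_lt (hclose d H.lt_d le_rfl h))
  have hex : ∃ m : ℕ, ∃ x : Fin (p + q), (γ.invol x).val = m ∧
      γ.invol f < x ∧ x ≤ d ∧ x ≤ γ.invol x := ⟨_, d, rfl, H.lt_d, le_rfl, hdd.le⟩
  classical
  obtain ⟨x, hx, hjx, hxd, hxx⟩ := Nat.find_spec hex
  have hmin : ∀ y, γ.invol f < y → y ≤ d → y ≤ γ.invol y → γ.invol x ≤ γ.invol y := by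
    intro y h1 h2 h3
    rw [Fin.le_def, hx]
    exact Nat.find_min' hex ⟨y, rfl, h1, h2, h3⟩
  have hdx := hN x hjx hxx
  have hD : ∀ s m, (γ.invol f).val < m → m ≤ d.val → τ.rank s m < γ.rank s m := by
    intro s m h1 h2
    have := H.rank_mono_strict s h2 fun y hmy hyd =>
      have hjy : γ.invol f < y := Fin.lt_def.2 (by omega)
      ⟨fun h => hfix y hjy hyd h.1, hclose y hjy hyd⟩
    have := rank_le_of_le H.le s (d.val + 1)
    omega
  obtain ⟨γ', h1, h2, h3, h4, h5, h6⟩ :=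
    γ.exists_cross_of_disjoint hfj hjx (hxd.trans_lt hdx) rfl rfl
  have hrank := rank_le_of_le H.le
  have hJ1 : ∀ a b : ℕ, f.val < a → a ≤ b → (γ.invol f).val < b → b ≤ d.val →
      γ.rankJ a b < τ.rankJ a b := by
    intro a b hfa hab hjb hbd
    refine H.rankJ_lt hfa (by omega) hjb hbd fun y hfy hya hby => ?_
    rcases lt_trichotomy y (γ.invol f) with h | h | h
    · exact hC y hfy h (Fin.lt_def.2 (by omega))
    · rw [h, γ.invol_invol] at hby
      omega
    · exact hN y h (Fin.le_def.2 (by omega))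
  have hJ2 : ∀ a b : ℕ, (γ.invol f).val < a → a ≤ b → b ≤ d.val →
      γ.rankJ a b + 2 ≤ τ.rankJ a b := by
    intro a b hja hab hbd
    have e1 := γ.rank_add_rank_add_rankJ (i := b) (by omega) true
    have e2 := τ.rank_add_rank_add_rankJ (i := b) (by omega) true
    have e3 := hD true b (by omega) hbd
    have e4 := hD (!true) b (by omega) hbd
    have e5 := γ.rankJ_split_left b hab
    have e6 := τ.rankJ_split_left b hab
    have : _ ≤ ((Finset.univ : Finset (Fin (p + q))).filter (fun z =>
      (a ≤ z.val ∧ z.val < b) ∧ b ≤ (γ.invol z).val)).card :=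
      Finset.card_le_card (s := (Finset.univ : Finset (Fin (p + q))).filter (fun z =>
        (a ≤ z.val ∧ z.val < b) ∧ b ≤ (τ.invol z).val)) (by
        intro z h
        simp only [Finset.mem_filter, Finset.mem_univ, true_and] at h ⊢
        refine ⟨h.1, ?_⟩
        have hjz : γ.invol f < z := Fin.lt_def.2 (by omega)
        have hzd : z ≤ d := Fin.le_def.2 (by omega)
        have hzz : z ≤ γ.invol z := by
          by_contra hcon
          have hlt := not_le.1 hcon
          have := H.invol_eq_of_invol_lt (hclose z hjz hzd hlt)
          rw [this] at h
          omega
        have := hN z hjz hzz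
        omega)
    omega
  have hJ3 : ∀ a b : ℕ, (γ.invol f).val < a → a ≤ x.val → d.val < b → b ≤ (γ.invol x).val →
      γ.rankJ a b < τ.rankJ a b := by
    intro a b hja hax hdb hbx
    have hlt : γ.rankJ b a < τ.rankJ b a := by
      refine H.rankJ_lt (by omega) (by omega) hja (by omega) fun y hfy hyb hay => ?_
      by_contra hcon
      have hjy : γ.invol f < γ.invol y := Fin.lt_def.2 (by omega)
      rcases lt_or_ge (γ.invol (γ.invol y)) (γ.invol y) with h | h
      · have := hclose _ hjy (not_lt.1 hcon) h
        rw [γ.invol_invol] at this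
        exact this.not_gt hfy
      · have := hmin _ hjy (not_lt.1 hcon) h
        rw [γ.invol_invol] at this
        omega
    have := γ.rankJ_swap (a := a) (b := b) (by omega) (by omega)
    have := τ.rankJ_swap (a := a) (b := b) (by omega) (by omega)
    omega
  refine exists_of_move (f := f) ?_ (by rw [h1]; exact hjx.ne') ?_ ?_
  · exact Or.inr (Or.inr (Or.inr (Or.inr (Or.inr (Or.inr (Or.inl
      ⟨f, _, x, _, hfj, hjx, hxd.trans_lt hdx, rfl, rfl, h1, h2, h3, h4⟩))))))
  · intro t m
    have e1 := h5 t m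
    have e2 := hrank t m
    split_ifs at e1 with h
    · have := hD t m h.1 (by omega)
      omega
    · omega
  · intro a b hab
    have hJ := h6 a b hab.le
    have hle := H.le.2.2 a b hab
    have hxd' := Fin.le_def.1 hxd
    have hjx' := Fin.lt_def.1 hjx
    by_cases hA : f.val < a ∧ (γ.invol f).val < b ∧ b ≤ x.val
    · by_cases hja : (γ.invol f).val < a
      · have := hJ2 a b hja hab.le (by omega)
        split_ifs at hJ <;> omega
      · have := hJ1 a b hA.1 hab.le hA.2.1 (by omega)
        rw [if_pos hA, if_neg (by omega)] at hJ
        omega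
    · rw [if_neg hA] at hJ
      split_ifs at hJ with hB
      · rcases le_or_gt b d.val with hbd | hbd
        · have := hJ1 a b (by omega) hab.le (by omega) hbd
          omega
        · have := hJ3 a b hB.1 hB.2.1 hbd hB.2.2
          omega
      · omega

theorem exists_move (H : FirstDiff γ τ f d) :
    ∃ γ' : Clan p q, Clan.lt γ γ' ∧ Clan.le γ' τ ∧ IsMove γ γ' := by
  by_cases hC : ∀ x, f < x → x < γ.invol f → γ.invol f < γ.invol x → d < γ.invol x
  swap
  · push Not at hC
    exact H.exists_move_of_cross hC
  rcases H.f_le.eq_or_lt with hff | hff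
  · have hfv : (γ.invol f).val = f.val := congrArg Fin.val hff.symm
    refine H.exists_move_of_rank_eq (γ.sgn f) hC (fun _ => rfl) (u := f.val + 1) (by omega)
      H.f_lt_d (fun x h1 h2 => absurd (Fin.lt_def.1 h1) (by omega)) ?_
    have := H.rank_mono (!γ.sgn f) (Nat.le_add_right f.val 1) fun y h1 h2 => by
      obtain rfl : y = f := Fin.ext (by omega)
      exact ⟨fun h => by simp at h, fun h => absurd hff.symm h.ne⟩
    have := H.rank_eq (!γ.sgn f)
    omega
  have hvac : ∀ s, γ.invol f = f → γ.sgn f = s := fun _ h => absurd h hff.ne'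
  by_cases hN : ∀ x, γ.invol f < x → x ≤ γ.invol x → d < γ.invol x
  · exact H.exists_move_of_forall_lt hff hC hN
  push Not at hN
  have hex : ∃ m : ℕ, ∃ x : Fin (p + q), x.val = m ∧
      γ.invol f < x ∧ x ≤ γ.invol x ∧ γ.invol x ≤ d := by
    obtain ⟨x, hx⟩ := hN
    exact ⟨_, x, rfl, hx⟩
  classical
  obtain ⟨k, hk, hjk, hkk, hkd⟩ := Nat.find_spec hex
  have hmin : ∀ x, γ.invol f < x → x < k → x ≤ γ.invol x → d < γ.invol x := by
    intro x h1 h2 h3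
    by_contra hcon
    exact Nat.find_min hex (m := x.val) (by rw [← hk]; exact h2)
      ⟨x, rfl, h1, h3, not_lt.1 hcon⟩
  have hmin' : ∀ x, γ.invol f < x → x < k → x ≤ γ.invol x → γ.invol x ≤ d → γ.invol x = x :=
    fun x h1 h2 h3 h4 => absurd h4 (hmin x h1 h2 h3).not_ge
  have hkd' : k.val ≤ d.val := hkk.trans hkd
  have hmono : ∀ s, τ.rank s k < γ.rank s k →
      ∀ m : ℕ, (γ.invol f).val < m → m ≤ k.val → τ.rank s m < γ.rank s m := by
    intro s hs m hjm hmk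
    have := H.rank_mono s hmk fun y hmy hyk =>
      have hjy : γ.invol f < y := Fin.lt_def.2 (by omega)
      have hyd : y ≤ d := Fin.le_def.2 (by omega)
      ⟨fun h => (hmin y hjy hyk h.1.ge).not_ge (h.1.le.trans hyd),
        fun h => H.invol_lt_f hC hjy hyd h fun x h1 h2 => hmin' x h1 (h2.trans hyk)⟩
    omega
  have hs : ∃ s, τ.rank s k < γ.rank s k := by
    have hJ : γ.rankJ k k < τ.rankJ k k := by
      refine H.rankJ_lt (hff.trans hjk) (by omega) hjk hkd' fun x hfx hxk hkx => ?_
      rcases lt_trichotomy x (γ.invol f) with h | h | h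
      · exact hC x hfx h (hjk.trans_le hkx)
      · rw [h, γ.invol_invol] at hkx
        omega
      · exact hmin x h hxk (Fin.le_def.2 (by omega))
    by_contra hcon
    push Not at hcon
    have := γ.rank_add_rank_add_rankJ (i := k.val) (by omega) true
    have := τ.rank_add_rank_add_rankJ (i := k.val) (by omega) true
    have := hcon true
    have := hcon (!true)
    omega
  obtain ⟨s, hs⟩ := hs
  by_cases hks : γ.invol k = k ∧ γ.sgn k = s
  · by_cases ht : τ.rank (!s) k < γ.rank (!s) k
    · exact H.exists_move_at (!s) hC (hvac _) hjk hkk hkd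
        (fun h => by rw [hks.2] at h; simp at h) hmin' (hmono _ ht)
    · exact H.exists_move_of_rank_eq s hC (hvac _) hjk hkd' hmin (not_lt.1 ht)
  · exact H.exists_move_at s hC (hvac _) hjk hkk hkd hks hmin' (hmono s hs)

end FirstDiff

end Clan

/-- covering move existence: if `γ < τ` in the combinatorial Bruhat order
on `(p,q)`-clans, there is a `(p,q)`-clan `γ'` with `γ < γ' ≤ τ` obtained from `γ` by one
of the ten local moves. -/
theorem covering_move_exists {p q : ℕ} (γ τ : Clan p q) (h : Clan.lt γ τ) :
    ∃ γ' : Clan p q, Clan.lt γ γ' ∧ Clan.le γ' τ ∧ IsMove γ γ' := by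
  obtain ⟨f, d, H⟩ := Clan.exists_firstDiff h
  exact H.exists_move
end

section
/- The combinatorial Bruhat order on involutions defined by the rank conditions σ(i;·) ≥ ρ(i;·) for all i and σ(s;t) ≤ ρ(s;t) for all s < t is a partial order on the set of involutions of {1,...,n} (i.e., an involution is determined by its rank numbers σ(i;·) and σ(s;t)). -/
open Finset

/-- `σ(i;·)` for an involution `σ` of `{1,…,n}`. -/
def involDot {n : ℕ} (σ : Equiv.Perm (Fin n)) (i : ℕ) : ℕ :=
  ((Finset.univ : Finset (Fin n)).filter (fun a => σ a = a ∧ a.val < i)).card +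
  2 * ((Finset.univ : Finset (Fin n)).filter
      (fun a => a.val < (σ a).val ∧ (σ a).val < i)).card

/-- `σ(s;t)` for an involution `σ`: the number of 2-cycles `{a,b}` with `a ≤ s`, `b > t`. -/
def involJ {n : ℕ} (σ : Equiv.Perm (Fin n)) (s t : ℕ) : ℕ :=
  ((Finset.univ : Finset (Fin n)).filter (fun a => a.val < s ∧ t ≤ (σ a).val)).card

theorem involJ_succ {n : ℕ} (σ : Equiv.Perm (Fin n)) (a : Fin n) (t : ℕ) :
    involJ σ (a.val + 1) t = involJ σ a.val t + if t ≤ (σ a).val then 1 else 0 := by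
  unfold involJ
  split_ifs with h
  · have hins : (univ.filter fun b : Fin n => b.val < a.val + 1 ∧ t ≤ (σ b).val) =
        insert a (univ.filter fun b : Fin n => b.val < a.val ∧ t ≤ (σ b).val) := by
      ext b
      simp only [mem_filter, mem_univ, true_and, mem_insert, Fin.ext_iff]
      constructor
      · rintro ⟨hb, ht⟩
        by_cases hba : b.val = a.val
        · exact Or.inl hba
        · exact Or.inr ⟨by omega, ht⟩
      · rintro (hb | ⟨hb, ht⟩)
        · obtain rfl : b = a := Fin.ext hb
          exact ⟨by omega, h⟩
        · exact ⟨by omega, ht⟩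
    rw [hins, card_insert_of_notMem (by simp)]
  · rw [add_zero]
    congr 1
    ext b
    simp only [mem_filter, mem_univ, true_and]
    constructor
    · rintro ⟨hb, ht⟩
      refine ⟨?_, ht⟩
      have hba : b ≠ a := by rintro rfl; exact h ht
      have : b.val ≠ a.val := fun e => hba (Fin.ext e)
      omega
    · rintro ⟨hb, ht⟩
      exact ⟨by omega, ht⟩

/-- Each of the first `s` points is fixed, lies on a 2-cycle inside the first `s` points, or lies
on a 2-cycle leaving them. -/
theorem involDot_add_involJ_self {n : ℕ} (σ : Equiv.Perm (Fin n)) (hσ : ∀ a, σ (σ a) = a)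
    (s : ℕ) : involDot σ s + involJ σ s s = (univ.filter fun a : Fin n => a.val < s).card := by
  have hswap : (univ.filter fun a : Fin n => (σ a).val < a.val ∧ a.val < s).card =
      (univ.filter fun a : Fin n => a.val < (σ a).val ∧ (σ a).val < s).card := by
    refine card_bij' (fun a _ => σ a) (fun a _ => σ a) ?_ ?_ ?_ ?_ <;> simp [hσ]
  unfold involDot involJ
  rw [two_mul]
  nth_rewrite 2 [← hswap]
  simp only [card_filter, ← sum_add_distrib]
  refine sum_congr rfl fun a _ => ?_
  simp only [Fin.ext_iff]
  split_ifs <;> omega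

/-- An involution is determined by the rank numbers `σ(s;t)` with `s ≤ t`. -/
theorem eq_of_involJ_eq {n : ℕ} {σ ρ : Equiv.Perm (Fin n)}
    (hσ : ∀ a, σ (σ a) = a) (hρ : ∀ a, ρ (ρ a) = a)
    (h : ∀ s t, s ≤ t → involJ σ s t = involJ ρ s t) : σ = ρ := by
  have hle : ∀ (a : Fin n) (t : ℕ), a.val < t → (t ≤ (σ a).val ↔ t ≤ (ρ a).val) := by
    intro a t ht
    have h₁ := h (a.val + 1) t ht
    rw [involJ_succ, involJ_succ, h a.val t ht.le] at h₁
    split_ifs at h₁ <;> omega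
  have hlt : ∀ a : Fin n, a.val < (σ a).val ∨ a.val < (ρ a).val → σ a = ρ a := by
    intro a ha
    have h₀ := hle a (a.val + 1) (by omega)
    have h₁ := hle a (σ a).val
    have h₂ := hle a (ρ a).val
    apply Fin.ext
    omega
  ext1 a
  by_cases h₁ : (σ a).val < a.val
  · have := hlt (σ a) (Or.inl (by rwa [hσ]))
    rw [hσ] at this
    calc σ a = ρ (ρ (σ a)) := (hρ _).symm
      _ = ρ a := by rw [← this]
  by_cases h₂ : (ρ a).val < a.val
  · have := hlt (ρ a) (Or.inr (by rwa [hρ]))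
    rw [hρ] at this
    calc σ a = σ (σ (ρ a)) := by rw [this]
      _ = ρ a := hσ _
  by_cases h₃ : a.val < (σ a).val ∨ a.val < (ρ a).val
  · exact hlt a h₃
  · apply Fin.ext
    omega

/-- the combinatorial Bruhat order on involutions of `{1,…,n}`, given by
the rank conditions on `σ(i;·)` and `σ(s;t)`, is a partial order; equivalently
(antisymmetry, the nontrivial point) an involution is determined by its rank numbers. -/
theorem involution_bruhat_partial_order {n : ℕ} (σ ρ : Equiv.Perm (Fin n))
    (hσ : ∀ a, σ (σ a) = a) (hρ : ∀ a, ρ (ρ a) = a)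
    (h1 : ∀ i, involDot ρ i ≤ involDot σ i)
    (h2 : ∀ s t, s < t → involJ σ s t ≤ involJ ρ s t)
    (h1' : ∀ i, involDot σ i ≤ involDot ρ i)
    (h2' : ∀ s t, s < t → involJ ρ s t ≤ involJ σ s t) :
    σ = ρ := by
  refine eq_of_involJ_eq hσ hρ fun s t hst => ?_
  rcases hst.lt_or_eq with hlt | rfl
  · exact (h2 s t hlt).antisymm (h2' s t hlt)
  · have hs := involDot_add_involJ_self σ hσ s
    have hr := involDot_add_involJ_self ρ hρ s
    have := h1 s
    have := h1' s
    omega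
end
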